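/- For every positive integer n, det( C(i+j+3, 2i-j+1) + C(i+j+2, 2i-j) )_{0≤i,j≤n-2} = ( ∏_{i=0}^{n-1} (3i+1)! / (n+i)! )², which is CSSC(2n), the number of cyclically symmetric self-complementary tilings of the regular hexagon of side 2n. -/

import Mathlib

open Finset

/-- Binomial coefficient `C(m,k)` for `m : ℕ` and `k : ℤ`, zero if `k < 0` or `k > m`. -/
def C (m : ℕ) (k : ℤ) : ℚ := if 0 ≤ k then (m.choose k.toNat : ℚ) else 0

section Condensation

open Matrix

variable {K : Type*} [Field K]

/-- The equivalence sending the extra point to `0`. -/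
def finSumUnitEquivZero (n : ℕ) : Fin n ⊕ Unit ≃ Fin (n + 1) :=
  (Equiv.optionEquivSumPUnit (Fin n)).symm.trans (finSuccEquiv n).symm

/-- The equivalence sending the extra point to `Fin.last n`. -/
def finSumUnitEquivLast (n : ℕ) : Fin n ⊕ Unit ≃ Fin (n + 1) :=
  (Equiv.optionEquivSumPUnit (Fin n)).symm.trans finSuccEquivLast.symm

/-- The equivalence sending the two extra points to `0` and `Fin.last (n + 1)`. -/
noncomputable def finSumFinTwoEquivEnds (n : ℕ) : Fin n ⊕ Fin 2 ≃ Fin (n + 2) :=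
  Equiv.ofBijective (Sum.elim (fun i => i.castSucc.succ) ![0, Fin.last (n + 1)]) <| by
    rw [Fintype.bijective_iff_injective_and_card]
    refine ⟨?_, by simp⟩
    rintro (i | i) (j | j) h
    · simpa using h
    · fin_cases j <;> (simp [Fin.ext_iff] at h; try omega)
    · fin_cases i <;> (simp [Fin.ext_iff] at h; try omega)
    · fin_cases i <;> fin_cases j <;> simp [Fin.ext_iff] at h ⊢

/-- **Desnanot–Jacobi identity** (Dodgson condensation), for an invertible interior. -/
theorem det_mul_det_interior {n : ℕ} (M : Matrix (Fin (n + 2)) (Fin (n + 2)) K)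
    (h : (M.submatrix (fun i : Fin n => i.castSucc.succ) (fun i => i.castSucc.succ)).det ≠ 0) :
    M.det * (M.submatrix (fun i : Fin n => i.castSucc.succ) (fun i => i.castSucc.succ)).det =
      (M.submatrix Fin.castSucc Fin.castSucc).det * (M.submatrix Fin.succ Fin.succ).det -
      (M.submatrix Fin.succ Fin.castSucc).det * (M.submatrix Fin.castSucc Fin.succ).det := by
  set m : Fin n → Fin (n + 2) := fun i => i.castSucc.succ
  set B := M.submatrix m m
  have : Invertible B := B.invertibleOfIsUnitDet h.isUnit
  set S : Matrix (Fin (n + 2)) (Fin (n + 2)) K := M - M.submatrix id m * ⅟B * M.submatrix m id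
  have bordered (p q : Fin (n + 2)) (e f : Fin n ⊕ Unit → Fin (n + 2))
      (he : e = Sum.elim m fun _ => p) (hf : f = Sum.elim m fun _ => q) :
      (M.submatrix e f).det = B.det * S p q := by
    subst he hf
    have : M.submatrix (Sum.elim m fun _ : Unit => p) (Sum.elim m fun _ : Unit => q) =
        fromBlocks B (M.submatrix m fun _ => q) (M.submatrix (fun _ => p) m)
          (M.submatrix (fun _ => p) fun _ => q) := by
      ext (i | i) (j | j) <;> rfl
    rw [this, det_fromBlocks₁₁]
    congr 1
    rw [det_unique]
    rfl
  have hM : M.det = B.det * (S 0 0 * S (Fin.last _) (Fin.last _) -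
      S 0 (Fin.last _) * S (Fin.last _) 0) := by
    rw [← det_submatrix_equiv_self (finSumFinTwoEquivEnds n)]
    have : M.submatrix (finSumFinTwoEquivEnds n) (finSumFinTwoEquivEnds n) =
        fromBlocks B (M.submatrix m ![0, Fin.last (n + 1)]) (M.submatrix ![0, Fin.last (n + 1)] m)
          (M.submatrix ![0, Fin.last (n + 1)] ![0, Fin.last (n + 1)]) := by
      ext (i | i) (j | j) <;> rfl
    rw [this, det_fromBlocks₁₁, det_fin_two]
    rfl
  have he₀ : Fin.castSucc ∘ finSumUnitEquivZero n = Sum.elim m fun _ => 0 := by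
    ext (i | i) <;> simp [finSumUnitEquivZero, m]
  have heL : Fin.succ ∘ finSumUnitEquivLast n = Sum.elim m fun _ => Fin.last (n + 1) := by
    ext (i | i) <;> simp [finSumUnitEquivLast, m]
  have h₀₀ : (M.submatrix Fin.castSucc Fin.castSucc).det = B.det * S 0 0 := by
    rw [← det_submatrix_equiv_self (finSumUnitEquivZero n), submatrix_submatrix]
    exact bordered _ _ _ _ he₀ he₀
  have hLL : (M.submatrix Fin.succ Fin.succ).det =
      B.det * S (Fin.last _) (Fin.last _) := by
    rw [← det_submatrix_equiv_self (finSumUnitEquivLast n), submatrix_submatrix]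
    exact bordered _ _ _ _ heL heL
  set σ : Equiv.Perm (Fin (n + 1)) := (finSumUnitEquivLast n).symm.trans (finSumUnitEquivZero n)
  have hL₀ : (Equiv.Perm.sign σ⁻¹ : K) * (M.submatrix Fin.succ Fin.castSucc).det =
      B.det * S (Fin.last _) 0 := by
    rw [← bordered _ _ _ _ heL he₀, ← submatrix_submatrix]
    exact (det_reindex (finSumUnitEquivLast n).symm (finSumUnitEquivZero n).symm _).symm
  have h₀L : (Equiv.Perm.sign σ : K) * (M.submatrix Fin.castSucc Fin.succ).det =
      B.det * S 0 (Fin.last _) := by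
    rw [← bordered _ _ _ _ he₀ heL, ← submatrix_submatrix]
    exact (det_reindex (finSumUnitEquivZero n).symm (finSumUnitEquivLast n).symm _).symm
  have hσ : (Equiv.Perm.sign σ : K) * (Equiv.Perm.sign σ : K) = 1 := by
    norm_cast
    simp
  rw [Equiv.Perm.sign_inv] at hL₀
  rw [hM, h₀₀, hLL]
  linear_combination (-(M.submatrix Fin.succ Fin.castSucc).det *
    (M.submatrix Fin.castSucc Fin.succ).det) * hσ +
    (Equiv.Perm.sign σ : K) * (M.submatrix Fin.castSucc Fin.succ).det * hL₀ +
    B.det * S (Fin.last _) 0 * h₀L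

end Condensation

/-- The reciprocal factorial `1 / k!`, zero for negative `k`. -/
def invFactorial (k : ℤ) : ℚ := if 0 ≤ k then 1 / (k.toNat.factorial : ℚ) else 0

theorem invFactorial_natCast (k : ℕ) : invFactorial k = 1 / (k.factorial : ℚ) := by
  simp [invFactorial]

theorem invFactorial_of_neg {k : ℤ} (hk : k < 0) : invFactorial k = 0 := by
  simp [invFactorial, hk]

/-- The matrix with entries `(x + y + i + j - 1)! / ((x + 2i - j)! (y + 2j - i)!)`. -/
def factorialMatrix (n : ℕ) (x y : ℤ) : Matrix (Fin n) (Fin n) ℚ :=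
  fun i j => ((x + y + i + j - 1).toNat.factorial : ℚ) *
    invFactorial (x + 2 * i - j) * invFactorial (y + 2 * j - i)

/-- The `i`-th factor of the determinant of `factorialMatrix`, equal to
`i! (x+y+i-1)! (2x+y+3i-1)! (x+2y+3i-1)! / ((2x+y+2i-1)! (x+2y+2i-1)! (x+2i)! (y+2i)!)`. -/
def detFactor (i x y : ℕ) : ℚ :=
  (i.factorial * (x + y + i).factorial * (2 * x + y + 3 * i).factorial *
      (x + 2 * y + 3 * i).factorial * (2 * x + y + 2 * i : ℕ) * (x + 2 * y + 2 * i : ℕ)) /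
    ((2 * x + y + 2 * i).factorial * (x + 2 * y + 2 * i).factorial * (x + 2 * i).factorial *
      (y + 2 * i).factorial * (x + y + i : ℕ) * (2 * x + y + 3 * i : ℕ) * (x + 2 * y + 3 * i : ℕ))

/-- The difference `detFactor i (x + 1) (y + 1) - detFactor (i + 1) x y`. -/
def detFactorDiff (i x y : ℕ) : ℚ :=
  (i.factorial * (x + y + i).factorial * (2 * x + y + 3 * i + 2).factorial *
      (x + 2 * y + 3 * i + 2).factorial * (x * y * (x + y))) /
    ((2 * x + y + 2 * i + 2).factorial * (x + 2 * y + 2 * i + 2).factorial *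
      (x + 2 * i + 2).factorial * (y + 2 * i + 2).factorial)

theorem detFactor_pos {i x y : ℕ} (h : 0 < x + y) : 0 < detFactor i x y := by
  have h₁ : 0 < 2 * x + y + 2 * i := by omega
  have h₂ : 0 < x + 2 * y + 2 * i := by omega
  have h₃ : 0 < x + y + i := by omega
  have h₄ : 0 < 2 * x + y + 3 * i := by omega
  have h₅ : 0 < x + 2 * y + 3 * i := by omega
  unfold detFactor
  positivity

theorem detFactor_sub (i x y : ℕ) :
    detFactor i (x + 1) (y + 1) - detFactor (i + 1) x y = detFactorDiff i x y := by
  unfold detFactor detFactorDiff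
  rw [show x + 1 + (y + 1) + i = x + y + i + 1 + 1 by ring,
    show 2 * (x + 1) + (y + 1) + 3 * i = 2 * x + y + 3 * i + 2 + 1 by ring,
    show x + 1 + 2 * (y + 1) + 3 * i = x + 2 * y + 3 * i + 2 + 1 by ring,
    show 2 * (x + 1) + (y + 1) + 2 * i = 2 * x + y + 2 * i + 2 + 1 by ring,
    show x + 1 + 2 * (y + 1) + 2 * i = x + 2 * y + 2 * i + 2 + 1 by ring,
    show x + 1 + 2 * i = x + 2 * i + 1 by ring,
    show y + 1 + 2 * i = y + 2 * i + 1 by ring,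
    show x + y + (i + 1) = x + y + i + 1 by ring,
    show 2 * x + y + 3 * (i + 1) = 2 * x + y + 3 * i + 2 + 1 by ring,
    show x + 2 * y + 3 * (i + 1) = x + 2 * y + 3 * i + 2 + 1 by ring,
    show 2 * x + y + 2 * (i + 1) = 2 * x + y + 2 * i + 2 by ring,
    show x + 2 * y + 2 * (i + 1) = x + 2 * y + 2 * i + 2 by ring,
    show x + 2 * (i + 1) = x + 2 * i + 1 + 1 by ring,
    show y + 2 * (i + 1) = y + 2 * i + 1 + 1 by ring]
  simp only [Nat.factorial_succ (x + y + i + 1), Nat.factorial_succ (x + y + i),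
    Nat.factorial_succ (2 * x + y + 3 * i + 2), Nat.factorial_succ (x + 2 * y + 3 * i + 2),
    Nat.factorial_succ (2 * x + y + 2 * i + 2), Nat.factorial_succ (x + 2 * y + 2 * i + 2),
    Nat.factorial_succ (x + 2 * i + 1), Nat.factorial_succ (y + 2 * i + 1), Nat.factorial_succ i]
  push_cast
  field_simp
  ring

theorem detFactor_mul_detFactorDiff (i x y : ℕ) :
    detFactor (i + 1) (x + 3) y * detFactor (i + 1) x (y + 3) * detFactorDiff i (x + 1) (y + 1) =
      detFactorDiff (i + 1) (x + 1) (y + 1) * detFactor (i + 1) (x + 1) (y + 1) *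
        detFactor i (x + 2) (y + 2) := by
  unfold detFactor detFactorDiff
  obtain ⟨a, ha⟩ : ∃ a, a = x + y + i := ⟨_, rfl⟩
  obtain ⟨b, hb⟩ : ∃ b, b = 2 * x + y + 3 * i := ⟨_, rfl⟩
  obtain ⟨c, hc⟩ : ∃ c, c = x + 2 * y + 3 * i := ⟨_, rfl⟩
  obtain ⟨d, hd⟩ : ∃ d, d = 2 * x + y + 2 * i := ⟨_, rfl⟩
  obtain ⟨e, he⟩ : ∃ e, e = x + 2 * y + 2 * i := ⟨_, rfl⟩
  obtain ⟨u, hu⟩ : ∃ u, u = x + 2 * i := ⟨_, rfl⟩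
  obtain ⟨v, hv⟩ : ∃ v, v = y + 2 * i := ⟨_, rfl⟩
  rw [
    show x + 3 + y + (i + 1) = a + 4 by omega,
    show 2 * (x + 3) + y + 3 * (i + 1) = b + 9 by omega,
    show x + 3 + 2 * y + 3 * (i + 1) = c + 6 by omega,
    show 2 * (x + 3) + y + 2 * (i + 1) = d + 8 by omega,
    show x + 3 + 2 * y + 2 * (i + 1) = e + 5 by omega,
    show x + 3 + 2 * (i + 1) = u + 5 by omega,
    show y + 2 * (i + 1) = v + 2 by omega,
    show x + (y + 3) + (i + 1) = a + 4 by omega,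
    show 2 * x + (y + 3) + 3 * (i + 1) = b + 6 by omega,
    show x + 2 * (y + 3) + 3 * (i + 1) = c + 9 by omega,
    show 2 * x + (y + 3) + 2 * (i + 1) = d + 5 by omega,
    show x + 2 * (y + 3) + 2 * (i + 1) = e + 8 by omega,
    show x + 2 * (i + 1) = u + 2 by omega,
    show y + 3 + 2 * (i + 1) = v + 5 by omega,
    show x + 1 + (y + 1) + i = a + 2 by omega,
    show 2 * (x + 1) + (y + 1) + 3 * i = b + 3 by omega,
    show x + 1 + 2 * (y + 1) + 3 * i = c + 3 by omega,
    show 2 * (x + 1) + (y + 1) + 2 * i = d + 3 by omega,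
    show x + 1 + 2 * (y + 1) + 2 * i = e + 3 by omega,
    show x + 1 + 2 * i = u + 1 by omega,
    show y + 1 + 2 * i = v + 1 by omega,
    show x + 1 + (y + 1) + (i + 1) = a + 3 by omega,
    show 2 * (x + 1) + (y + 1) + 3 * (i + 1) = b + 6 by omega,
    show x + 1 + 2 * (y + 1) + 3 * (i + 1) = c + 6 by omega,
    show 2 * (x + 1) + (y + 1) + 2 * (i + 1) = d + 5 by omega,
    show x + 1 + 2 * (y + 1) + 2 * (i + 1) = e + 5 by omega,
    show x + 1 + 2 * (i + 1) = u + 3 by omega,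
    show y + 1 + 2 * (i + 1) = v + 3 by omega,
    show x + 2 + (y + 2) + i = a + 4 by omega,
    show 2 * (x + 2) + (y + 2) + 3 * i = b + 6 by omega,
    show x + 2 + 2 * (y + 2) + 3 * i = c + 6 by omega,
    show 2 * (x + 2) + (y + 2) + 2 * i = d + 6 by omega,
    show x + 2 + 2 * (y + 2) + 2 * i = e + 6 by omega,
    show x + 2 + 2 * i = u + 2 by omega,
    show y + 2 + 2 * i = v + 2 by omega]
  simp only [Nat.factorial_succ]
  push_cast
  field_simp
  ring

theorem prod_detFactor_mul_prod_detFactor (n x y : ℕ) :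
    (∏ i ∈ range (n + 1), detFactor i (x + 3) y) * ∏ i ∈ range (n + 1), detFactor i x (y + 3) =
      detFactorDiff n (x + 1) (y + 1) * (∏ i ∈ range (n + 1), detFactor i (x + 1) (y + 1)) *
        ∏ i ∈ range n, detFactor i (x + 2) (y + 2) := by
  induction n with
  | zero =>
    simp only [zero_add, prod_range_one, prod_range_zero, detFactor, detFactorDiff, mul_zero,
      add_zero]
    rw [show x + 3 + y = x + y + 2 + 1 by ring, show x + (y + 3) = x + y + 2 + 1 by ring,
      show x + 1 + (y + 1) = x + y + 2 by ring]
    simp only [Nat.factorial_succ]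
    push_cast
    field_simp
    ring
  | succ n ih =>
    rw [prod_range_succ, prod_range_succ (fun i => detFactor i x (y + 3)),
      prod_range_succ (fun i => detFactor i (x + 1) (y + 1)),
      prod_range_succ (fun i => detFactor i (x + 2) (y + 2))]
    have hne : detFactorDiff n (x + 1) (y + 1) ≠ 0 := by
      unfold detFactorDiff
      positivity
    refine mul_left_cancel₀ hne ?_
    linear_combination detFactorDiff n (x + 1) (y + 1) * detFactor (n + 1) (x + 3) y *
        detFactor (n + 1) x (y + 3) * ih +
      (detFactorDiff n (x + 1) (y + 1) * (∏ i ∈ range (n + 1), detFactor i (x + 1) (y + 1)) *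
        ∏ i ∈ range n, detFactor i (x + 2) (y + 2)) * detFactor_mul_detFactorDiff n x y

theorem det_factorialMatrix_of_neg_left (n : ℕ) {x : ℤ} (hx : x < 0) (y : ℤ) :
    (factorialMatrix (n + 1) x y).det = 0 :=
  Matrix.det_eq_zero_of_row_eq_zero 0 fun j => by
    have : x + 2 * ((0 : Fin (n + 1)) : ℕ) - (j : ℕ) < 0 := by simp; omega
    simp only [factorialMatrix, invFactorial_of_neg this, mul_zero, zero_mul]

theorem det_factorialMatrix_of_neg_right (n : ℕ) (x : ℤ) {y : ℤ} (hy : y < 0) :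
    (factorialMatrix (n + 1) x y).det = 0 :=
  Matrix.det_eq_zero_of_column_eq_zero 0 fun i => by
    have : y + 2 * ((0 : Fin (n + 1)) : ℕ) - (i : ℕ) < 0 := by simp; omega
    simp only [factorialMatrix, invFactorial_of_neg this, mul_zero]

theorem factorialMatrix_submatrix {m n : ℕ} (x y : ℤ) (r c : ℕ) (f g : Fin m → Fin n)
    (hf : ∀ i, (f i : ℕ) = i + r) (hg : ∀ j, (g j : ℕ) = j + c) :
    (factorialMatrix n x y).submatrix f g =
      factorialMatrix m (x + 2 * r - c) (y + 2 * c - r) := by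
  ext i j
  simp only [Matrix.submatrix_apply, factorialMatrix, hf, hg]
  push_cast
  ring_nf

theorem det_factorialMatrix_mul_det_factorialMatrix (n : ℕ) (x y : ℤ)
    (h : (factorialMatrix n (x + 1) (y + 1)).det ≠ 0) :
    (factorialMatrix (n + 2) x y).det * (factorialMatrix n (x + 1) (y + 1)).det =
      (factorialMatrix (n + 1) x y).det * (factorialMatrix (n + 1) (x + 1) (y + 1)).det -
      (factorialMatrix (n + 1) (x + 2) (y - 1)).det *
        (factorialMatrix (n + 1) (x - 1) (y + 2)).det := by
  have key := det_mul_det_interior (factorialMatrix (n + 2) x y)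
  rw [factorialMatrix_submatrix x y 1 1 _ _ (by simp) (by simp),
    factorialMatrix_submatrix x y 0 0 _ _ (by simp) (by simp),
    factorialMatrix_submatrix x y 1 1 _ _ (by simp) (by simp),
    factorialMatrix_submatrix x y 1 0 _ _ (by simp) (by simp),
    factorialMatrix_submatrix x y 0 1 _ _ (by simp) (by simp)] at key
  push_cast at key
  ring_nf at key h ⊢
  exact key h

/-- The two-parameter determinant evaluation behind the Mills–Robbins–Rumsey determinants. -/
theorem det_factorialMatrix (n x y : ℕ) (h : 0 < x + y) :
    (factorialMatrix n x y).det = ∏ i ∈ range n, detFactor i x y := by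
  induction n using Nat.twoStepInduction generalizing x y with
  | zero => simp
  | one =>
    obtain ⟨s, hs⟩ : ∃ s, x + y = s + 1 := ⟨x + y - 1, by omega⟩
    have hs' : ((x : ℤ) + y - 1).toNat = s := by omega
    have hd : ((2 * x + y : ℕ) : ℚ) ≠ 0 := by norm_cast; omega
    have he : ((x + 2 * y : ℕ) : ℚ) ≠ 0 := by norm_cast; omega
    simp only [Matrix.det_unique, factorialMatrix, detFactor, prod_range_one, Fin.default_eq_zero,
      Fin.val_zero, Nat.cast_zero, mul_zero, add_zero, sub_zero, invFactorial_natCast, hs', hs,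
      Nat.factorial_succ]
    push_cast at hd he ⊢
    field_simp
    simp
  | more n ih₀ ih₁ =>
    have h₀ := ih₀ (x + 1) (y + 1) (by omega)
    have hpos : 0 < ∏ i ∈ range n, detFactor i (x + 1) (y + 1) :=
      prod_pos fun i _ => detFactor_pos (by omega)
    have h₁ := ih₁ (x + 1) (y + 1) (by omega)
    push_cast at h₀ h₁
    have key := det_factorialMatrix_mul_det_factorialMatrix n x y (by rw [h₀]; exact hpos.ne')
    have hoff : (factorialMatrix (n + 1) (x + 2) (y - 1)).det *
        (factorialMatrix (n + 1) (x - 1) (y + 2)).det =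
        detFactorDiff n x y * (∏ i ∈ range (n + 1), detFactor i x y) *
          ∏ i ∈ range n, detFactor i (x + 1) (y + 1) := by
      rcases x with - | x
      · rw [det_factorialMatrix_of_neg_left n (x := (0 : ℕ) - 1) (by simp)]
        simp [detFactorDiff]
      rcases y with - | y
      · rw [det_factorialMatrix_of_neg_right n _ (y := (0 : ℕ) - 1) (by simp)]
        simp [detFactorDiff]
      rw [← prod_detFactor_mul_prod_detFactor, ← ih₁ (x + 3) y (by omega),
        ← ih₁ x (y + 3) (by omega)]
      push_cast
      ring_nf
    rw [hoff, h₀, h₁, ih₁ x y h, prod_range_succ (fun i => detFactor i (x + 1) (y + 1))] at key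
    rw [prod_range_succ]
    refine mul_right_cancel₀ hpos.ne' (key.trans ?_)
    rw [← detFactor_sub]
    ring

theorem C_succ_add_C (m : ℕ) (k : ℤ) :
    C (m + 1) (k + 1) + C m k =
      (m + k + 2) * (m.factorial * invFactorial (k + 1) * invFactorial (m - k)) := by
  obtain hk | rfl | hk : k < -1 ∨ k = -1 ∨ 0 ≤ k := by omega
  · simp [C, invFactorial, show ¬ 0 ≤ k + 1 by omega, show ¬ 0 ≤ k by omega]
  · have : invFactorial ((m : ℤ) - -1) = 1 / ((m + 1).factorial : ℚ) := by
      rw [← invFactorial_natCast]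
      simp
    rw [this]
    simp only [C, invFactorial, Nat.factorial_succ]
    push_cast
    simp
    field_simp
    ring
  · lift k to ℕ using hk
    have hC (a b : ℕ) : C a b = a.choose b := by simp [C]
    rw [← Nat.cast_succ, hC, hC, invFactorial_natCast]
    obtain hkm | hkm := lt_or_ge m k
    · rw [invFactorial_of_neg (by omega), Nat.choose_eq_zero_of_lt hkm,
        Nat.choose_eq_zero_of_lt (by omega)]
      simp
    · rw [← Nat.cast_sub hkm, invFactorial_natCast, Nat.cast_choose ℚ hkm,
        Nat.cast_choose ℚ (Nat.succ_le_succ hkm), Nat.succ_sub_succ, Nat.factorial_succ k,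
        Nat.factorial_succ m]
      push_cast
      field_simp
      ring

theorem prod_factorial_div_factorial_succ (n : ℕ) :
    ∏ i ∈ range (n + 1), (((3 * i + 1).factorial : ℚ) / ((n + 1 + i).factorial : ℚ)) =
      (∏ i ∈ range n, (((3 * i + 1).factorial : ℚ) / ((n + i).factorial : ℚ))) *
        ((3 * n + 1).factorial * n.factorial /
          ((2 * n).factorial * (2 * n + 1).factorial)) := by
  have h : (∏ i ∈ range (n + 1), ((n + 1 + i).factorial : ℚ)) * n.factorial =
      (∏ i ∈ range n, ((n + i).factorial : ℚ)) * ((2 * n).factorial * (2 * n + 1).factorial) := by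
    have h' : ∏ i ∈ range (n + 2), ((n + i).factorial : ℚ) =
        (∏ i ∈ range (n + 1), ((n + 1 + i).factorial : ℚ)) * n.factorial := by
      rw [prod_range_succ']
      refine congrArg₂ _ (prod_congr rfl fun i _ => ?_) rfl
      rw [show n + (i + 1) = n + 1 + i by ring]
    rw [prod_range_succ, prod_range_succ] at h'
    rw [← h', two_mul, ← add_assoc, mul_assoc]
  have h₁ : ∏ i ∈ range (n + 1), ((n + 1 + i).factorial : ℚ) ≠ 0 := by positivity
  have h₂ : ∏ i ∈ range n, ((n + i).factorial : ℚ) ≠ 0 := by positivity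
  rw [prod_div_distrib, prod_div_distrib, prod_range_succ (fun i => ((3 * i + 1).factorial : ℚ)),
    div_mul_div_comm, div_eq_div_iff h₁ (by positivity), ← h]
  ring

theorem prod_mul_prod_detFactor_one_two (n : ℕ) :
    (∏ i ∈ range n, (3 * i + 4 : ℚ)) * ∏ i ∈ range n, detFactor i 1 2 =
      (∏ i ∈ range (n + 1), (((3 * i + 1).factorial : ℚ) / ((n + 1 + i).factorial : ℚ))) ^ 2 := by
  induction n with
  | zero => simp
  | succ n ih =>
    rw [prod_factorial_div_factorial_succ, mul_pow, ← ih, prod_range_succ,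
      prod_range_succ (fun i => detFactor i 1 2), mul_mul_mul_comm]
    congr 1
    unfold detFactor
    rw [show 1 + 2 + n = n + 1 + 1 + 1 by ring, show 2 * 1 + 2 + 3 * n = 3 * n + 3 + 1 by ring,
      show 1 + 2 * 2 + 3 * n = 3 * n + 3 + 1 + 1 by ring,
      show 2 * 1 + 2 + 2 * n = 2 * n + 2 + 1 + 1 by ring,
      show 1 + 2 * 2 + 2 * n = 2 * n + 2 + 1 + 1 + 1 by ring,
      show 1 + 2 * n = 2 * n + 1 by ring, show 2 + 2 * n = 2 * n + 1 + 1 by ring,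
      show 3 * (n + 1) + 1 = 3 * n + 3 + 1 by ring, show 2 * (n + 1) = 2 * n + 1 + 1 by ring]
    simp only [Nat.factorial_succ]
    push_cast
    field_simp
    ring

theorem det_W_two (n : ℕ) (hn : 0 < n) :
    Matrix.det (fun i j : Fin (n - 1) =>
        C ((i : ℕ) + (j : ℕ) + 3) (2 * (i : ℤ) - (j : ℤ) + 1) +
          C ((i : ℕ) + (j : ℕ) + 2) (2 * (i : ℤ) - (j : ℤ))) =
      (∏ i ∈ Finset.range n,
        (((3 * i + 1).factorial : ℚ) / ((n + i).factorial : ℚ))) ^ 2 := by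
  obtain ⟨m, rfl⟩ : ∃ m, n = m + 1 := ⟨n - 1, by omega⟩
  rw [Nat.add_sub_cancel, ← prod_mul_prod_detFactor_one_two, ← det_factorialMatrix m 1 2 (by simp),
    ← Fin.prod_univ_eq_prod_range (fun i => (3 * i + 4 : ℚ)), ← Matrix.det_mul_column]
  congr 1
  ext i j
  rw [C_succ_add_C, Matrix.of_apply, factorialMatrix]
  congr 1
  · push_cast
    ring
  · rw [Nat.cast_one, Nat.cast_ofNat,
      show ((1 : ℤ) + 2 + (i : ℕ) + (j : ℕ) - 1).toNat = i + j + 2 by omega,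
      show (1 : ℤ) + 2 * (i : ℕ) - (j : ℕ) = 2 * (i : ℕ) - (j : ℕ) + 1 by ring,
      show (2 : ℤ) + 2 * (j : ℕ) - (i : ℕ) =
        ((i + j + 2 : ℕ) : ℤ) - (2 * (i : ℕ) - (j : ℕ)) by push_cast; ring]
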